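/- (Net-utility improvement condition.) In a finite-horizon MDP with rewards in [0, R_max] and horizon H, let π_L and π_gc be policies such that for every state s there exist α(s) ∈ [0,1] and a probability mass function ρ_s with π_gc(a ∣ s) = α(s)·π_L(a ∣ s) + (1−α(s))·ρ_s(a) for all a. Let λ ≥ 0, let T_{π_L}, T_{π_gc} : S → ℝ be deployment-cost functions, and define the net utility J_π(s₀) = V_H^π(s₀) − λ·T_π(s₀). If λ·(T_{π_L}(s₀) − T_{π_gc}(s₀)) > 2·H·R_max · ∑_{t=0}^{H−1} E_{s∼d_{π_L,t}}[1 − α(s)], then J_{π_gc}(s₀) > J_{π_L}(s₀). -/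

import Mathlib

/-- A finite-horizon MDP with finite state and action spaces: a transition kernel `P`
(given as a probability mass function over next states), and a reward function `r`
with values in `[0, Rmax]`. -/
structure FinMDP (S A : Type) [Fintype S] [Fintype A] where
  P : S → A → S → ℝ
  P_nonneg : ∀ s a s', 0 ≤ P s a s'
  P_sum : ∀ s a, ∑ s', P s a s' = 1
  r : S → A → ℝ
  Rmax : ℝ
  r_nonneg : ∀ s a, 0 ≤ r s a
  r_le_Rmax : ∀ s a, r s a ≤ Rmax

variable {S A : Type} [Fintype S] [Fintype A]

/-- A policy assigns to each state a probability mass function over actions. -/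
def IsPolicy (π : S → A → ℝ) : Prop :=
  (∀ s a, 0 ≤ π s a) ∧ ∀ s, ∑ a, π s a = 1

/-- The `n`-step value function: `V 0 s = 0` and
`V (n+1) s = E_{a∼π(s)}[r s a + E_{s'∼P(s,a)}[V n s']]`. -/
def FinMDP.V (M : FinMDP S A) (π : S → A → ℝ) : ℕ → S → ℝ
  | 0, _ => 0
  | n + 1, s => ∑ a, π s a * (M.r s a + ∑ s', M.P s a s' * M.V π n s')

/-- The state-visitation distribution at time `t`, starting from `s₀`. -/
def FinMDP.visit [DecidableEq S] (M : FinMDP S A) (π : S → A → ℝ) (s₀ : S) : ℕ → S → ℝ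
  | 0, s => if s = s₀ then 1 else 0
  | t + 1, s' => ∑ s, M.visit π s₀ t s * ∑ a, π s a * M.P s a s'

theorem V_bounds (M : FinMDP S A) (hR : 0 ≤ M.Rmax) (π : S → A → ℝ) (h : IsPolicy π) (n : ℕ) :
    ∀ s, 0 ≤ M.V π n s ∧ M.V π n s ≤ n * M.Rmax := by
  induction n with
  | zero => intro s; simp [FinMDP.V]
  | succ n ih =>
    intro s
    have hQ0 : ∀ a, 0 ≤ M.r s a + ∑ s', M.P s a s' * M.V π n s' := fun a =>
      add_nonneg (M.r_nonneg s a)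
        (Finset.sum_nonneg fun s' _ => mul_nonneg (M.P_nonneg s a s') (ih s').1)
    have hQ1 : ∀ a, M.r s a + ∑ s', M.P s a s' * M.V π n s' ≤ (n + 1 : ℝ) * M.Rmax := by
      intro a
      have h1 : ∑ s', M.P s a s' * M.V π n s' ≤ ∑ s', M.P s a s' * (n * M.Rmax) :=
        Finset.sum_le_sum fun s' _ => mul_le_mul_of_nonneg_left (ih s').2 (M.P_nonneg s a s')
      rw [← Finset.sum_mul, M.P_sum] at h1
      linarith [M.r_le_Rmax s a]
    constructor
    · exact Finset.sum_nonneg fun a _ => mul_nonneg (h.1 s a) (hQ0 a)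
    · have h1 : M.V π (n + 1) s ≤ ∑ a, π s a * ((n + 1 : ℝ) * M.Rmax) :=
        Finset.sum_le_sum fun a _ => mul_le_mul_of_nonneg_left (hQ1 a) (h.1 s a)
      rw [← Finset.sum_mul, h.2] at h1
      push_cast
      linarith

theorem visit_nonneg [DecidableEq S] (M : FinMDP S A) (π : S → A → ℝ) (h : IsPolicy π)
    (s₀ : S) (t : ℕ) : ∀ s, 0 ≤ M.visit π s₀ t s := by
  induction t with
  | zero => intro s; unfold FinMDP.visit; split_ifs <;> norm_num
  | succ t ih =>
    intro s
    exact Finset.sum_nonneg fun x _ => mul_nonneg (ih x)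
      (Finset.sum_nonneg fun a _ => mul_nonneg (h.1 x a) (M.P_nonneg x a s))

theorem visit_push [DecidableEq S] (M : FinMDP S A) (π : S → A → ℝ)
    (s₀ : S) (t : ℕ) (f : S → ℝ) :
    ∑ s, M.visit π s₀ t s * ∑ a, π s a * ∑ s', M.P s a s' * f s'
      = ∑ s', M.visit π s₀ (t + 1) s' * f s' := by
  simp only [FinMDP.visit, Finset.sum_mul, Finset.mul_sum]
  conv_rhs => rw [Finset.sum_comm]
  refine Finset.sum_congr rfl fun s _ => ?_
  rw [Finset.sum_comm]
  refine Finset.sum_congr rfl fun s' _ => Finset.sum_congr rfl fun a _ => ?_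
  ring

theorem V_step (M : FinMDP S A) (hR : 0 ≤ M.Rmax) (πL πgc : S → A → ℝ)
    (hL : IsPolicy πL) (hgc : IsPolicy πgc)
    (α : S → ℝ) (ρ : S → A → ℝ) (hα1 : ∀ s, α s ≤ 1) (hρ0 : ∀ s a, 0 ≤ ρ s a)
    (hmix : ∀ s a, πgc s a = α s * πL s a + (1 - α s) * ρ s a) (n : ℕ) (s : S) :
    M.V πL (n + 1) s - M.V πgc (n + 1) s ≤ (n + 1 : ℝ) * M.Rmax * (1 - α s)
      + ∑ a, πL s a * ∑ s', M.P s a s' * (M.V πL n s' - M.V πgc n s') := by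
  have hb := V_bounds M hR πgc hgc n
  have key : ∀ a, πL s a * (M.r s a + ∑ s', M.P s a s' * M.V πL n s')
      - πgc s a * (M.r s a + ∑ s', M.P s a s' * M.V πgc n s')
      ≤ πL s a * ((n + 1 : ℝ) * M.Rmax * (1 - α s))
        + πL s a * ∑ s', M.P s a s' * (M.V πL n s' - M.V πgc n s') := by
    intro a
    have h0 : 0 ≤ ∑ s', M.P s a s' * M.V πgc n s' :=
      Finset.sum_nonneg fun s' _ => mul_nonneg (M.P_nonneg s a s') (hb s').1
    have h1 : ∑ s', M.P s a s' * M.V πgc n s' ≤ ∑ s', M.P s a s' * (n * M.Rmax) :=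
      Finset.sum_le_sum fun s' _ => mul_le_mul_of_nonneg_left (hb s').2 (M.P_nonneg s a s')
    rw [← Finset.sum_mul, M.P_sum] at h1
    simp only [mul_sub, Finset.sum_sub_distrib]
    rw [hmix]
    set q := ∑ s', M.P s a s' * M.V πgc n s'
    have hα : 0 ≤ 1 - α s := by linarith [hα1 s]
    have e1 : 0 ≤ (1 - α s) * (ρ s a * (M.r s a + q)) :=
      mul_nonneg hα (mul_nonneg (hρ0 s a) (add_nonneg (M.r_nonneg s a) h0))
    have e2 : 0 ≤ (1 - α s) * (πL s a * ((n + 1 : ℝ) * M.Rmax - (M.r s a + q))) :=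
      mul_nonneg hα (mul_nonneg (hL.1 s a) (by linarith [M.r_le_Rmax s a]))
    linarith
  have h := Finset.sum_le_sum fun a (_ : a ∈ Finset.univ) => key a
  rw [Finset.sum_sub_distrib, Finset.sum_add_distrib, ← Finset.sum_mul, hL.2, one_mul] at h
  exact h

theorem V_gap [DecidableEq S] (M : FinMDP S A) (hR : 0 ≤ M.Rmax) (πL πgc : S → A → ℝ)
    (hL : IsPolicy πL) (hgc : IsPolicy πgc)
    (α : S → ℝ) (ρ : S → A → ℝ) (hα1 : ∀ s, α s ≤ 1) (hρ0 : ∀ s a, 0 ≤ ρ s a)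
    (hmix : ∀ s a, πgc s a = α s * πL s a + (1 - α s) * ρ s a) (s₀ : S) (H : ℕ) (n : ℕ) :
    ∀ t, n ≤ H → ∑ s, M.visit πL s₀ t s * (M.V πL n s - M.V πgc n s) ≤
      H * M.Rmax * ∑ k ∈ Finset.range n, ∑ s, M.visit πL s₀ (t + k) s * (1 - α s) := by
  induction n with
  | zero => intro t _; simp [FinMDP.V]
  | succ n ih =>
    intro t hn
    have h1 := ih (t + 1) (by omega)
    have hn' : (n + 1 : ℝ) ≤ H := by exact_mod_cast hn
    have h2 : ∑ s, M.visit πL s₀ t s * (M.V πL (n + 1) s - M.V πgc (n + 1) s) ≤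
        ∑ s, (H * M.Rmax * (M.visit πL s₀ t s * (1 - α s)) + M.visit πL s₀ t s *
          ∑ a, πL s a * ∑ s', M.P s a s' * (M.V πL n s' - M.V πgc n s')) := by
      refine Finset.sum_le_sum fun s _ => ?_
      have hv := visit_nonneg M πL hL s₀ t s
      have a1 := mul_le_mul_of_nonneg_left
        (V_step M hR πL πgc hL hgc α ρ hα1 hρ0 hmix n s) hv
      have hα : 0 ≤ 1 - α s := by linarith [hα1 s]
      have a2 : 0 ≤ (H - (n + 1 : ℝ)) * (M.Rmax * (M.visit πL s₀ t s * (1 - α s))) :=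
        mul_nonneg (by linarith) (mul_nonneg hR (mul_nonneg hv hα))
      linarith
    rw [Finset.sum_add_distrib, visit_push, ← Finset.mul_sum] at h2
    rw [Finset.sum_range_succ', mul_add]
    have e : ∑ k ∈ Finset.range n, ∑ s, M.visit πL s₀ (t + (k + 1)) s * (1 - α s)
        = ∑ k ∈ Finset.range n, ∑ s, M.visit πL s₀ (t + 1 + k) s * (1 - α s) := by
      refine Finset.sum_congr rfl fun k _ => ?_
      rw [show t + (k + 1) = t + 1 + k by omega]
    rw [e, add_zero]
    linarith

/-- **Net-utility improvement condition.** With the mixture structure of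
the composed policy, if the cost advantage `λ·(T_{π_L}(s₀) − T_{π_gc}(s₀))` strictly
exceeds `2·H·Rmax · ∑_{t<H} E_{s∼d_{π_L,t}}[1 − α(s)]`, then the net utility
`J_π(s₀) = V_H^π(s₀) − λ·T_π(s₀)` satisfies `J_{π_gc}(s₀) > J_{π_L}(s₀)`. -/
theorem stmt_6 [DecidableEq S] (M : FinMDP S A) (πL πgc : S → A → ℝ)
    (hL : IsPolicy πL) (hgc : IsPolicy πgc)
    (α : S → ℝ) (ρ : S → A → ℝ)
    (hα0 : ∀ s, 0 ≤ α s) (hα1 : ∀ s, α s ≤ 1)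
    (hρ0 : ∀ s a, 0 ≤ ρ s a) (hρ1 : ∀ s, ∑ a, ρ s a = 1)
    (hmix : ∀ s a, πgc s a = α s * πL s a + (1 - α s) * ρ s a)
    (lam : ℝ) (hlam : 0 ≤ lam) (TL Tgc : S → ℝ)
    (H : ℕ) (s₀ : S)
    (hcost : lam * (TL s₀ - Tgc s₀) >
      2 * H * M.Rmax * ∑ t ∈ Finset.range H, ∑ s, M.visit πL s₀ t s * (1 - α s)) :
    M.V πgc H s₀ - lam * Tgc s₀ > M.V πL H s₀ - lam * TL s₀ := by
  have hR : 0 ≤ M.Rmax := by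
    by_cases hA : Nonempty A
    · obtain ⟨a⟩ := hA
      exact (M.r_nonneg s₀ a).trans (M.r_le_Rmax s₀ a)
    · have := not_nonempty_iff.mp hA
      have h := hL.2 s₀
      simp at h
  have h := V_gap M hR πL πgc hL hgc α ρ hα1 hρ0 hmix s₀ H H 0 le_rfl
  simp only [zero_add] at h
  have h0 : ∑ s, M.visit πL s₀ 0 s * (M.V πL H s - M.V πgc H s)
      = M.V πL H s₀ - M.V πgc H s₀ := by simp [FinMDP.visit]
  rw [h0] at h
  have hX : 0 ≤ H * M.Rmax *
      ∑ t ∈ Finset.range H, ∑ s, M.visit πL s₀ t s * (1 - α s) :=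
    mul_nonneg (mul_nonneg (Nat.cast_nonneg H) hR)
      (Finset.sum_nonneg fun t _ => Finset.sum_nonneg fun s _ =>
        mul_nonneg (visit_nonneg M πL hL s₀ t s) (by linarith [hα1 s]))
  linarith
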